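/- (Theorem 2(i), sufficiency) Suppose α > 0, κ ≠ 0, n = 0, and fix ε ∈ (0, ε₀]. If B_ε(Y) < κ^{−1} for every Y ∈ [0,R], then the function V^ε(Y) = −∫_Y^R F^{−1}(B_ε(s)) ds, where F^{−1} : [0, κ^{−1}) → [0,∞) is the inverse of the strictly increasing map F : [0,∞) → [0, κ^{−1}), is a classical solution of class C²([0,R]) of the regularized steady problem (1/(Y+ε)) d/dY[ (1 + κ^α |V'(Y)|^α)^{(n−1)/α} (Y+ε) V'(Y) ] = b(Y) on (0,R), V'(0) = 0, V(R) = 0. -/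

import Mathlib

open Set Filter Real intervalIntegral

/-- The Carreau–Yasuda flux function `F(η) = (1 + κ^α |η|^α)^((n-1)/α) · η`. -/
noncomputable def Fcy (α κ n : ℝ) (η : ℝ) : ℝ :=
  (1 + κ ^ α * |η| ^ α) ^ ((n - 1) / α) * η

/-- The regularized averaged pressure gradient
`B_ε(Y) = (1/(Y+ε)) ∫₀^Y (s+ε) b(s) ds`. -/
noncomputable def Bf (b : ℝ → ℝ) (ε Y : ℝ) : ℝ :=
  (Y + ε)⁻¹ * ∫ s in (0:ℝ)..Y, (s + ε) * b s

/-- `V` solves the regularized steady problem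
`(1/(Y+ε)) d/dY[ (1+κ^α |V'|^α)^{(n-1)/α} (Y+ε) V' ] = b(Y)` on `(0,R)` with
`V'(0) = 0`, `V(R) = 0`, the derivatives being taken within `[0,R]`. -/
def IsSteadySol (α κ n R ε : ℝ) (b V : ℝ → ℝ) : Prop :=
  (∀ Y ∈ Ioo 0 R,
    HasDerivWithinAt
      (fun y => (1 + κ ^ α * |derivWithin V (Icc 0 R) y| ^ α) ^ ((n - 1) / α) *
        ((y + ε) * derivWithin V (Icc 0 R) y)) ((Y + ε) * b Y) (Icc 0 R) Y) ∧
  derivWithin V (Icc 0 R) 0 = 0 ∧ V R = 0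

/-- The explicit inverse `y ↦ y (1 - κ^α |y|^α)^(-1/α)` of the flux function for `n = 0`. -/
noncomputable def fluxInv (α κ y : ℝ) : ℝ :=
  y * (1 - κ ^ α * |y| ^ α) ^ (-(1 / α))

theorem one_sub_flux_pos {α κ y : ℝ} (hα : 0 < α) (hκ : 0 < κ) (hy : y ∈ Ico 0 κ⁻¹) :
    0 < 1 - κ ^ α * |y| ^ α := by
  have h1 : κ * y < 1 := by
    have := mul_lt_mul_of_pos_left hy.2 hκ
    rwa [mul_inv_cancel₀ hκ.ne'] at this
  rw [abs_of_nonneg hy.1, ← mul_rpow hκ.le hy.1]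
  have := rpow_lt_one (mul_nonneg hκ.le hy.1) h1 hα
  linarith

theorem Fcy_fluxInv {α κ y : ℝ} (hα : 0 < α) (hκ : 0 < κ) (hy : y ∈ Ico 0 κ⁻¹) :
    Fcy α κ 0 (fluxInv α κ y) = y := by
  have hp := one_sub_flux_pos hα hκ hy
  have habs : |fluxInv α κ y| ^ α = |y| ^ α * (1 - κ ^ α * |y| ^ α)⁻¹ := by
    rw [fluxInv, abs_mul, abs_of_pos (rpow_pos_of_pos hp _),
      mul_rpow (abs_nonneg y) (rpow_pos_of_pos hp _).le, ← rpow_mul hp.le,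
      show -(1 / α) * α = -1 by field_simp, rpow_neg_one]
  have hsum : 1 + κ ^ α * (|y| ^ α * (1 - κ ^ α * |y| ^ α)⁻¹) = (1 - κ ^ α * |y| ^ α)⁻¹ := by
    have := hp.ne'
    field_simp
    ring
  rw [Fcy, habs, hsum, fluxInv, inv_rpow hp.le, ← rpow_neg hp.le, mul_left_comm, ← rpow_add hp,
    show -((0 - 1) / α) + -(1 / α) = 0 by ring, rpow_zero, mul_one]

theorem hasDerivAt_fluxInv {α κ y : ℝ} (hα : 0 < α) (hκ : 0 < κ) (hy : y ∈ Ico 0 κ⁻¹) :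
    HasDerivAt (fluxInv α κ) ((1 - κ ^ α * |y| ^ α) ^ (-(1 / α) - 1)) y := by
  have hp := one_sub_flux_pos hα hκ hy
  rcases hy.1.eq_or_lt with h0 | h0
  · subst h0
    rw [hasDerivAt_iff_tendsto_slope]
    have hc : ContinuousAt (fun x : ℝ => (1 - κ ^ α * |x| ^ α) ^ (-(1 / α))) 0 := by
      refine ContinuousAt.rpow_const ?_ (Or.inl hp.ne')
      exact continuousAt_const.sub
        (continuousAt_const.mul (continuous_abs.continuousAt.rpow_const (Or.inr hα.le)))
    have ht := hc.tendsto.mono_left (nhdsWithin_le_nhds (s := {0}ᶜ))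
    simp only [abs_zero, zero_rpow hα.ne', mul_zero, sub_zero, one_rpow] at ht ⊢
    refine ht.congr' ?_
    filter_upwards [self_mem_nhdsWithin] with x hx
    have hx : x ≠ 0 := hx
    simp [slope_def_field, fluxInv, mul_div_cancel_left₀ _ hx]
  · rw [abs_of_pos h0] at hp ⊢
    have h1 : HasDerivAt (fun x : ℝ => 1 - κ ^ α * x ^ α) (-(κ ^ α * (α * y ^ (α - 1)))) y :=
      ((hasDerivAt_rpow_const (Or.inl h0.ne')).const_mul _).const_sub 1
    have h2 := (hasDerivAt_id y).mul (h1.rpow_const (p := -(1 / α)) (Or.inl hp.ne'))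
    have h3 : HasDerivAt (fluxInv α κ) _ y := h2.congr_of_eventuallyEq (by
      filter_upwards [lt_mem_nhds h0] with x hx
      simp [fluxInv, abs_of_pos hx])
    convert h3 using 1
    have e1 : (1 - κ ^ α * y ^ α) ^ (-(1 / α))
        = (1 - κ ^ α * y ^ α) ^ (-(1 / α) - 1) * (1 - κ ^ α * y ^ α) := by
      rw [rpow_sub_one hp.ne', div_mul_cancel₀ _ hp.ne']
    have e2 : y ^ (α - 1) * y = y ^ α := by
      rw [rpow_sub_one h0.ne', div_mul_cancel₀ _ h0.ne']
    simp only [id]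
    rw [e1]
    generalize (1 - κ ^ α * y ^ α) ^ (-(1 / α) - 1) = P
    have e3 : y * (-(κ ^ α * (α * y ^ (α - 1))) * -(1 / α) * P) = κ ^ α * y ^ α * P := by
      rw [← e2]
      field_simp
    rw [e3]
    ring

theorem contDiffOn_fluxInv {α κ : ℝ} (hα : 0 < α) (hκ : 0 < κ) :
    ContDiffOn ℝ 1 (fluxInv α κ) (Ico 0 κ⁻¹) := by
  have hu : UniqueDiffOn ℝ (Ico 0 κ⁻¹) := uniqueDiffOn_Ico _ _
  rw [show (1 : WithTop ℕ∞) = 0 + 1 from (zero_add 1).symm, contDiffOn_succ_iff_derivWithin hu]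
  refine ⟨fun y hy => (hasDerivAt_fluxInv hα hκ hy).differentiableAt.differentiableWithinAt,
    by simp, contDiffOn_zero.2 ?_⟩
  have hc : ContinuousOn (fun y : ℝ => (1 - κ ^ α * |y| ^ α) ^ (-(1 / α) - 1)) (Ico 0 κ⁻¹) := by
    refine ContinuousOn.rpow_const ?_ fun y hy => Or.inl (one_sub_flux_pos hα hκ hy).ne'
    exact continuousOn_const.sub
      (continuousOn_const.mul (continuous_abs.continuousOn.rpow_const fun _ _ => Or.inr hα.le))
  exact hc.congr fun y hy => (hasDerivAt_fluxInv hα hκ hy).hasDerivWithinAt.derivWithin (hu y hy)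

theorem hasDerivWithinAt_integral_Icc {a c x₀ x : ℝ} {f : ℝ → ℝ}
    (hf : ContinuousOn f (Icc a c)) (hx₀ : x₀ ∈ Icc a c) (hx : x ∈ Icc a c) :
    HasDerivWithinAt (fun y => ∫ s in x₀..y, f s) (f x) (Icc a c) x := by
  have hac : a ≤ c := hx.1.trans hx.2
  have hcont : Continuous (IccExtend hac ((Icc a c).domRestrict f)) :=
    hf.domRestrict.Icc_extend'
  have heq : ∀ y ∈ Icc a c, IccExtend hac ((Icc a c).domRestrict f) y = f y := fun y hy => by
    rw [IccExtend_of_mem _ _ hy, domRestrict_apply]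
  have hint : ∀ y ∈ Icc a c,
      ∫ s in x₀..y, f s = ∫ s in x₀..y, IccExtend hac ((Icc a c).domRestrict f) s := fun y hy =>
    integral_congr fun s hs => (heq s (uIcc_subset_Icc hx₀ hy hs)).symm
  have h := (hcont.integral_hasStrictDerivAt x₀ x).hasDerivAt.hasDerivWithinAt (s := Icc a c)
  rw [heq x hx] at h
  exact h.congr hint (hint x hx)

theorem contDiffOn_integral_Icc {a c x₀ : ℝ} {f : ℝ → ℝ} {m : ℕ} (hac : a < c)
    (hf : ContDiffOn ℝ m f (Icc a c)) (hx₀ : x₀ ∈ Icc a c) :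
    ContDiffOn ℝ (m + 1) (fun y => ∫ s in x₀..y, f s) (Icc a c) := by
  have hu := uniqueDiffOn_Icc hac
  have hd := fun x hx => hasDerivWithinAt_integral_Icc (x := x) hf.continuousOn hx₀ hx
  rw [contDiffOn_succ_iff_derivWithin hu]
  exact ⟨fun x hx => (hd x hx).differentiableWithinAt, by simp,
    hf.congr fun x hx => (hd x hx).derivWithin (hu x hx)⟩

theorem contDiffOn_Bf {b : ℝ → ℝ} {ε R : ℝ} (hR : 0 < R) (hε : 0 < ε)
    (hb : ContinuousOn b (Icc 0 R)) : ContDiffOn ℝ 1 (Bf b ε) (Icc 0 R) := by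
  have hf : ContDiffOn ℝ (0 : ℕ) (fun s => (s + ε) * b s) (Icc 0 R) :=
    contDiffOn_zero.2 (((continuous_id.add continuous_const).continuousOn).mul hb)
  have h := contDiffOn_integral_Icc hR hf (left_mem_Icc.2 hR.le)
  rw [Nat.cast_zero, zero_add] at h
  refine ContDiffOn.mul (ContDiffOn.inv (by fun_prop) fun y hy => ?_) h
  have := hy.1
  positivity

theorem Bf_nonneg {b : ℝ → ℝ} {ε R Y : ℝ} (hε : 0 < ε) (hb : ∀ Y ∈ Icc 0 R, 0 ≤ b Y)
    (hY : Y ∈ Icc 0 R) : 0 ≤ Bf b ε Y := by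
  have h0 := hY.1
  refine mul_nonneg (by positivity) (integral_nonneg h0 fun s hs => ?_)
  exact mul_nonneg (add_nonneg hs.1 hε.le) (hb s ⟨hs.1, hs.2.trans hY.2⟩)

/-- Theorem 2(i), sufficiency: for `α > 0`, `κ ≠ 0`, `n = 0`,
`ε ∈ (0,ε₀]`: if `B_ε(Y) < κ⁻¹` on `[0,R]`, then
`V^ε(Y) = −∫_Y^R F⁻¹(B_ε(s)) ds`, with `F⁻¹ : [0,κ⁻¹) → [0,∞)` the inverse of the
strictly increasing map `F : [0,∞) → [0,κ⁻¹)`, is a `C²([0,R])` classical solution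
of the regularized steady problem. -/
theorem stmt4 (α κ n R b₀ ε₀ ε : ℝ) (b G : ℝ → ℝ)
    (hα : 0 < α) (hκ : 0 ≤ κ) (hκ' : κ ≠ 0) (hn : n = 0)
    (hR : 0 < R) (hε₀ : 0 < ε₀) (hε₀R : ε₀ < R) (hε : ε ∈ Ioc 0 ε₀)
    (hb : ContDiffOn ℝ 2 b (Icc 0 R))
    (hbb : ∀ Y ∈ Icc 0 R, 0 ≤ b Y ∧ b Y ≤ b₀)
    (hbne : ∃ Y ∈ Ioo 0 R, b Y ≠ 0)
    (hF : MapsTo (Fcy α κ n) (Ici 0) (Ico 0 κ⁻¹))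
    (hG : InvOn G (Fcy α κ n) (Ici 0) (Ico 0 κ⁻¹))
    (hB : ∀ Y ∈ Icc 0 R, Bf b ε Y < κ⁻¹) :
    ContDiffOn ℝ 2 (fun Y => -∫ s in Y..R, G (Bf b ε s)) (Icc 0 R) ∧
    IsSteadySol α κ n R ε b (fun Y => -∫ s in Y..R, G (Bf b ε s)) := by
  subst hn
  have hκ0 : 0 < κ := lt_of_le_of_ne hκ hκ'.symm
  have hε0 : 0 < ε := hε.1
  have hu := uniqueDiffOn_Icc hR
  have hGeq : ∀ y ∈ Ico 0 κ⁻¹, G y = fluxInv α κ y := fun y hy => by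
    have h0 : fluxInv α κ y ∈ Ici 0 :=
      mul_nonneg hy.1 (rpow_pos_of_pos (one_sub_flux_pos hα hκ0 hy) _).le
    simpa only [Fcy_fluxInv hα hκ0 hy] using hG.1 h0
  have hBmem : MapsTo (Bf b ε) (Icc 0 R) (Ico 0 κ⁻¹) := fun Y hY =>
    ⟨Bf_nonneg hε0 (fun y hy => (hbb y hy).1) hY, hB Y hY⟩
  have hw : ContDiffOn ℝ (1 : ℕ) (fun s => G (Bf b ε s)) (Icc 0 R) := by
    rw [Nat.cast_one]
    exact ((contDiffOn_fluxInv hα hκ0).comp (contDiffOn_Bf hR hε0 hb.continuousOn) hBmem).congr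
      fun y hy => hGeq _ (hBmem hy)
  have hRmem : R ∈ Icc 0 R := right_mem_Icc.2 hR.le
  have hV : (fun Y => -∫ s in Y..R, G (Bf b ε s)) = fun Y => ∫ s in R..Y, G (Bf b ε s) :=
    funext fun Y => (integral_symm Y R).symm
  rw [hV]
  have hder : ∀ y ∈ Icc 0 R,
      derivWithin (fun Y => ∫ s in R..Y, G (Bf b ε s)) (Icc 0 R) y = G (Bf b ε y) := fun y hy =>
    (hasDerivWithinAt_integral_Icc hw.continuousOn hRmem hy).derivWithin (hu y hy)
  refine ⟨?_, fun Y hY => ?_, ?_, integral_same⟩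
  · have h := contDiffOn_integral_Icc hR hw hRmem
    rwa [Nat.cast_one, one_add_one_eq_two] at h
  · have hflux : ContinuousOn (fun s => (s + ε) * b s) (Icc 0 R) :=
      ((continuous_id.add continuous_const).continuousOn).mul hb.continuousOn
    have hYm := Ioo_subset_Icc_self hY
    have heq : ∀ y ∈ Icc 0 R,
        (1 + κ ^ α * |derivWithin (fun Y => ∫ s in R..Y, G (Bf b ε s)) (Icc 0 R) y| ^ α) ^
            ((0 - 1) / α) *
          ((y + ε) * derivWithin (fun Y => ∫ s in R..Y, G (Bf b ε s)) (Icc 0 R) y) =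
        ∫ s in (0 : ℝ)..y, (s + ε) * b s := fun y hy => by
      have hF' : Fcy α κ 0 (G (Bf b ε y)) = Bf b ε y := hG.2 (hBmem hy)
      have hyε : y + ε ≠ 0 := (add_pos_of_nonneg_of_pos hy.1 hε0).ne'
      rw [hder y hy, mul_left_comm]
      change (y + ε) * Fcy α κ 0 (G (Bf b ε y)) = _
      rw [hF', Bf, mul_inv_cancel_left₀ hyε]
    exact (hasDerivWithinAt_integral_Icc hflux (left_mem_Icc.2 hR.le) hYm).congr heq (heq Y hYm)
  · have h0 : (0 : ℝ) ∈ Ico 0 κ⁻¹ := ⟨le_rfl, inv_pos.2 hκ0⟩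
    rw [hder 0 (left_mem_Icc.2 hR.le), show Bf b ε 0 = 0 by simp [Bf], hGeq 0 h0]
    simp [fluxInv]
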